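/- arXiv:1612.08022 — 2 statements merged into one kernel-verified Lean document; each statement's English description precedes it below -/
import Mathlib

section
/- Inseparability of the family of constraint cones: Let m = nq(N+1) + nx(N+1) + nu·N and identify ℝ^m with (ℝ^{nq})^{N+1} × (ℝ^{nx})^{N+1} × (ℝ^{nu})^N. For t = 0,…,N−1, let U_t ⊆ ℝ^{nu} be nonempty and convex, and let ẑ = (η̂_0,…,η̂_N, x̂_0,…,x̂_N, û_0,…,û_{N−1}) ∈ ℝ^m with û_t ∈ U_t for all t, η̂_0 = 0 and x̂_0 = x̄_0. Define Ω_u^t := (ℝ^{nq})^{N+1} × (ℝ^{nx})^{N+1} × (ℝ^{nu} × … × U_t × … × ℝ^{nu}), where U_t occupies the (t+1)-th of the N control factors, and Ω_B := {0} × (ℝ^{nq})^N × {x̄_0} × (ℝ^{nx})^N × (ℝ^{nu})^N. Let K_u^t(ẑ) and K_B(ẑ) denote the support cones of Ω_u^t and Ω_B with apex at ẑ. Then the family of convex cones K_u^0(ẑ),…,K_u^{N−1}(ẑ), K_B(ẑ) is inseparable in ℝ^m: there is no hyperplane separating one of these cones from the intersection of the others; that is, there exist no index i and nonzero linear functional ℓ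 on ℝ^m such that ℓ(z − ẑ) ≥ 0 for all z in the i-th cone and ℓ(z − ẑ) ≤ 0 for all z in the intersection of the remaining cones. -/
/-- The support cone of a convex set `Ω` with apex at `z0 ∈ Ω`:
`closure (⋃_{α>0} {z0 + α (z − z0) : z ∈ Ω})`. -/
def supportCone {E : Type*} [AddCommGroup E] [Module ℝ E] [TopologicalSpace E]
    (Ω : Set E) (z0 : E) : Set E :=
  closure (⋃ α ∈ Set.Ioi (0 : ℝ), (fun z => z0 + α • (z - z0)) '' Ω)

theorem subset_supportCone {E : Type*} [AddCommGroup E] [Module ℝ E] [TopologicalSpace E]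
    (Ω : Set E) (z0 : E) : Ω ⊆ supportCone Ω z0 := fun z hz =>
  subset_closure (Set.mem_biUnion (Set.mem_Ioi.2 one_pos) ⟨z, hz, by simp⟩)

/-- A functional vanishes if it is nonnegative on `A - z0` and nonpositive on `B - z0`, where
every vector is a sum of a vector pointing along a line through `z0` in `A` and one pointing
along a line through `z0` in `B`. -/
theorem LinearMap.eq_zero_of_separates {E : Type*} [AddCommGroup E] [Module ℝ E]
    {A B : Set E} {z0 : E} {l : E →ₗ[ℝ] ℝ}
    (hA : ∀ z ∈ A, 0 ≤ l (z - z0)) (hB : ∀ z ∈ B, l (z - z0) ≤ 0)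
    (h : ∀ v, ∃ w, (z0 + (v - w) ∈ A ∧ z0 + -(v - w) ∈ A) ∧ z0 + w ∈ B ∧ z0 + -w ∈ B) :
    l = 0 := by
  ext v
  obtain ⟨w, ⟨h1, h2⟩, h3, h4⟩ := h v
  have e1 := hA _ h1
  have e2 := hA _ h2
  have e3 := hB _ h3
  have e4 := hB _ h4
  simp only [add_sub_cancel_left, map_neg, map_sub] at e1 e2 e3 e4
  rw [LinearMap.zero_apply]
  linarith

/-- **Inseparability of the family of constraint cones.**
With `ℝᵐ` identified with `(ℝ^{nq})^{N+1} × (ℝ^{nx})^{N+1} × (ℝ^{nu})^N`, let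
`Ω_u^t` be the set where the `(t+1)`-th control factor lies in the nonempty convex set
`U t` (all other factors free), and `Ω_B` the affine set where the `0`-th `ℝ^{nq}` factor
is `0` and the `0`-th `ℝ^{nx}` factor is `x̄₀`.  If `ẑ` has `û t ∈ U t`, `η̂ 0 = 0`,
`x̂ 0 = x̄₀`, then the family of support cones `K_u^0(ẑ), …, K_u^{N−1}(ẑ), K_B(ẑ)` is
inseparable: no hyperplane (nonzero linear functional) separates one of these cones from
the intersection of the others. -/
theorem stmt_6 (nq nx nu N : ℕ)
    (U : Fin N → Set (Fin nu → ℝ))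
    (hU : ∀ t, (U t).Nonempty ∧ Convex ℝ (U t))
    (xbar0 : Fin nx → ℝ)
    (zhat : (Fin (N+1) → (Fin nq → ℝ)) × (Fin (N+1) → (Fin nx → ℝ))
              × (Fin N → (Fin nu → ℝ)))
    (hzu : ∀ t, zhat.2.2 t ∈ U t)
    (hzη : zhat.1 0 = 0) (hzx : zhat.2.1 0 = xbar0)
    -- the constraint sets
    (Ωu : Fin N → Set ((Fin (N+1) → (Fin nq → ℝ)) × (Fin (N+1) → (Fin nx → ℝ))
              × (Fin N → (Fin nu → ℝ))))
    (hΩu : ∀ t, Ωu t = {z | z.2.2 t ∈ U t})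
    (ΩB : Set ((Fin (N+1) → (Fin nq → ℝ)) × (Fin (N+1) → (Fin nx → ℝ))
              × (Fin N → (Fin nu → ℝ))))
    (hΩB : ΩB = {z | z.1 0 = 0 ∧ z.2.1 0 = xbar0})
    -- the family of support cones, indexed by `Fin (N+1)`, the last one being `K_B`
    (K : Fin (N+1) → Set ((Fin (N+1) → (Fin nq → ℝ)) × (Fin (N+1) → (Fin nx → ℝ))
              × (Fin N → (Fin nu → ℝ))))
    (hK : ∀ i : Fin (N+1), K i = if h : (i : ℕ) < N
            then supportCone (Ωu ⟨i, h⟩) zhat else supportCone ΩB zhat) :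
    ¬ ∃ (i : Fin (N+1))
        (ℓ : ((Fin (N+1) → (Fin nq → ℝ)) × (Fin (N+1) → (Fin nx → ℝ))
              × (Fin N → (Fin nu → ℝ))) →ₗ[ℝ] ℝ),
        ℓ ≠ 0 ∧ (∀ z ∈ K i, 0 ≤ ℓ (z - zhat)) ∧
        (∀ z ∈ ⋂ j ∈ ({j | j ≠ i} : Set (Fin (N+1))), K j, ℓ (z - zhat) ≤ 0) := by
  rintro ⟨i, l, hl, hA, hB⟩
  have hu : ∀ j : Fin (N+1), ∀ h : (j : ℕ) < N, ∀ v, v.2.2 ⟨j, h⟩ = 0 → zhat + v ∈ K j := by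
    intro j h v hv
    rw [hK, dif_pos h]
    apply subset_supportCone
    rw [hΩu]
    simpa [hv] using hzu ⟨j, h⟩
  have hb : ∀ j : Fin (N+1), ¬ (j : ℕ) < N → ∀ v, v.1 0 = 0 → v.2.1 0 = 0 → zhat + v ∈ K j := by
    intro j h v hv hv'
    rw [hK, dif_neg h]
    apply subset_supportCone
    rw [hΩB]
    simp [hv, hv', hzη, hzx]
  refine hl (LinearMap.eq_zero_of_separates hA hB fun v => ?_)
  simp only [Set.mem_iInter, Set.mem_ofPred_eq]
  by_cases hi : (i : ℕ) < N
  · refine ⟨(0, 0, Pi.single ⟨i, hi⟩ (v.2.2 ⟨i, hi⟩)),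
      ⟨hu i hi _ (by simp), hu i hi _ (by simp)⟩, ?_, ?_⟩ <;>
    · intro j hj
      by_cases h : (j : ℕ) < N
      · have hne : (⟨j, h⟩ : Fin N) ≠ ⟨i, hi⟩ := fun e => hj (Fin.ext (Fin.mk.inj e))
        exact hu j h _ (by simp [Pi.single_eq_of_ne hne])
      · exact hb j h _ (by simp) (by simp)
  · refine ⟨(Pi.single 0 (v.1 0), Pi.single 0 (v.2.1 0), 0),
      ⟨hb i hi _ (by simp) (by simp), hb i hi _ (by simp) (by simp)⟩, ?_, ?_⟩ <;>
    · intro j hj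
      have h : (j : ℕ) < N := by
        by_contra h
        exact hj (Fin.ext (by omega))
      exact hu j h _ (by simp)
end

section
/- First-order necessary optimality conditions for energy-optimal single-axis spacecraft maneuvers on SO(2): Let h > 0, c > 0, d > 0 with h·d < 1, and let N ∈ ℕ. Consider the problem of minimizing Σ_{t=0}^{N−1} u_t²/2 subject to R_{t+1} = R_t F(ω_t), ω_{t+1} = ω_t + h u_t, |u_t| ≤ c for t = 0,…,N−1, state constraints (ω_t² − d²)/2 ≤ 0 for t = 1,…,N−1, and fixed boundary conditions (R_0,ω_0) = (R_i,ω_i), (R_N,ω_N) = (R_f,ω_f). Define the Hamiltonian H^ν(ζ,ξ,R,ω,u) := ν u²/2 + ζ·arcsin(hω) + ξ(ω + hu) for ζ, ξ ∈ ℝ. If {û_t}_{t=0}^{N−1} is an optimal control with state trajectory {(R̂_t, ω̂_t)}_{t=0}^{N}, then there exist reals {(ζ^t, ξ^t)}_{t=0}^{N−1}, reals {μ^t}_{t=1}^{N−1}, and ν ∈ {−1, 0}, not all zero, such that: (i) ζ^{t−1} = ζ^t and ξ^{t−1} = hζ^t/√(1 − h²ω̂_t²) + ξ^t + μ^t ω̂_t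 for t = 1,…,N−1, while R̂_{t+1} = R̂_t F(ω̂_t) and ω̂_{t+1} = ω̂_t + h û_t; (ii) μ^t (ω̂_t² − d²) = 0 for t = 1,…,N−1; (iii) μ^t ≤ 0 for t = 1,…,N−1; (iv) for every t = 0,…,N−1, H^ν(ζ^t, ξ^t, R̂_t, ω̂_t, û_t) = max over w ∈ [−c,c] of H^ν(ζ^t, ξ^t, R̂_t, ω̂_t, w), equivalently û_t maximizes w ↦ ν w²/2 + ξ^t h w over [−c,c]. -/
/-- The group `SO(2)` of 2×2 real orthogonal matrices with determinant 1. -/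
def SO2 : Set (Matrix (Fin 2) (Fin 2) ℝ) :=
  {R | R * R.transpose = 1 ∧ R.det = 1}

/-- The integration step `F(ω)` of the discrete-time single-axis attitude dynamics. -/
noncomputable def Fstep (h ω : ℝ) : Matrix (Fin 2) (Fin 2) ℝ :=
  !![Real.sqrt (1 - h^2 * ω^2), -(h * ω); h * ω, Real.sqrt (1 - h^2 * ω^2)]

/-- The Hamiltonian of the energy-optimal single-axis maneuver problem:
`H^ν(ζ,ξ,R,ω,u) = ν u²/2 + ζ arcsin(hω) + ξ(ω + hu)` (it does not depend on `R`). -/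
noncomputable def HamSO2 (h ν ζ ξ ω u : ℝ) : ℝ :=
  ν * u^2 / 2 + ζ * Real.arcsin (h * ω) + ξ * (ω + h * u)

open Filter Topology

theorem hasDerivAt_max_zero_sq (x : ℝ) :
    HasDerivAt (fun t : ℝ => (max 0 t) ^ 2) (2 * max 0 x) x := by
  rw [hasDerivAt_iff_isLittleO]
  refine Asymptotics.IsBigO.trans_isLittleO (g := fun y => (y - x) ^ 2) ?_ ?_
  · refine Asymptotics.IsBigO.of_bound 1 (Eventually.of_forall fun y => ?_)
    simp only [smul_eq_mul, Real.norm_eq_abs, one_mul]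
    rw [abs_of_nonneg (sq_nonneg (y - x)), abs_le]
    rcases le_total 0 x with hx | hx <;> rcases le_total 0 y with hy | hy <;>
      simp only [hx, hy, max_eq_left, max_eq_right] <;> constructor <;> nlinarith
  · simpa using Asymptotics.isLittleO_pow_sub_sub x (m := 2) (by norm_num)

section FritzJohn

/-- The quadratic penalty measuring violation of the constraints `g i = 0` and `p j ≤ 0`. -/
noncomputable def quadraticPenalty {E ι κ : Type*} [Fintype ι] [Fintype κ] 
    (g : ι → E → ℝ) (p : κ → E → ℝ) (x : E) : ℝ :=
  ∑ i, g i x ^ 2 + ∑ j, (max 0 (p j x)) ^ 2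

theorem quadraticPenalty_nonneg {E ι κ : Type*} [Fintype ι] [Fintype κ] 
    (g : ι → E → ℝ) (p : κ → E → ℝ) (x : E) :
    0 ≤ quadraticPenalty g p x := by
  unfold quadraticPenalty; positivity

theorem quadraticPenalty_eq_zero_iff {E ι κ : Type*} [Fintype ι] [Fintype κ] 
    (g : ι → E → ℝ) (p : κ → E → ℝ) (x : E) :
    quadraticPenalty g p x = 0 ↔ (∀ i, g i x = 0) ∧ ∀ j, p j x ≤ 0 := by
  unfold quadraticPenalty
  rw [add_eq_zero_iff_of_nonneg (by positivity) (by positivity),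
    Finset.sum_eq_zero_iff_of_nonneg (fun _ _ => by positivity),
    Finset.sum_eq_zero_iff_of_nonneg (fun _ _ => by positivity)]
  simp

variable {E : Type*} [NormedAddCommGroup E] {ι κ : Type*} [Fintype ι] [Fintype κ]

/-- The proximal penalized objective. -/
noncomputable def penalizedObjective (f : E → ℝ) (g : ι → E → ℝ) (p : κ → E → ℝ) (x₀ : E)
    (k : ℝ) (x : E) : ℝ :=
  f x + ‖x - x₀‖ ^ 2 + k / 2 * quadraticPenalty g p x

theorem penalizedObjective_stationary [InnerProductSpace ℝ E] {K : Set E} (hK : Convex ℝ K)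
    {f : E → ℝ} {g : ι → E → ℝ} {p : κ → E → ℝ} {x₀ x : E} {k : ℝ} (hx : x ∈ K)
    (hmin : IsLocalMinOn (penalizedObjective f g p x₀ k) K x)
    (hf : DifferentiableAt ℝ f x) (hg : ∀ i, DifferentiableAt ℝ (g i) x)
    (hp : ∀ j, DifferentiableAt ℝ (p j) x) {y : E} (hy : y ∈ K) :
    0 ≤ fderiv ℝ f x (y - x) + 2 * inner ℝ (x - x₀) (y - x)
      + ∑ i, k * g i x * fderiv ℝ (g i) x (y - x)
      + ∑ j, k * max 0 (p j x) * fderiv ℝ (p j) x (y - x) := by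
  have h1 : HasFDerivAt (fun z : E => ‖z - x₀‖ ^ 2) _ x :=
    ((hasFDerivAt_id x).sub_const x₀).norm_sq
  have h2 := HasFDerivAt.fun_sum (u := Finset.univ) fun i _ => (hg i).hasFDerivAt.pow 2
  have h3 := HasFDerivAt.fun_sum (u := Finset.univ) fun j _ =>
    (hasDerivAt_max_zero_sq (p j x)).comp_hasFDerivAt x (hp j).hasFDerivAt
  have h4 := (hf.hasFDerivAt.add h1).add ((h2.add h3).const_mul (k / 2))
  have := hmin.hasFDerivWithinAt_nonneg h4.hasFDerivWithinAt
    (sub_mem_posTangentConeAt_of_segment_subset (hK.segment_subset hx hy))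
  refine this.trans_eq ?_
  generalize y - x = v
  simp only [id_eq, add_apply, smul_apply, sum_apply, ContinuousLinearMap.comp_apply,
    innerSL_apply_apply, ContinuousLinearMap.id_apply, smul_eq_mul, mul_add, Finset.mul_sum,
    ← add_assoc, nsmul_eq_mul, Nat.cast_ofNat, pow_one, Nat.add_one_sub_one]
  congr 1
  · congr 1
    exact Finset.sum_congr rfl fun i _ => by ring
  · exact Finset.sum_congr rfl fun i _ => by ring

theorem exists_tendsto_isLocalMinOn_penalizedObjective {K : Set E} (hK : IsCompact K)
    {f : E → ℝ} {g : ι → E → ℝ} {p : κ → E → ℝ} {x₀ : E} (hx₀ : x₀ ∈ K)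
    (hf : ∀ᶠ x in 𝓝 x₀, ContinuousAt f x) (hg : ∀ i, ∀ᶠ x in 𝓝 x₀, ContinuousAt (g i) x)
    (hp : ∀ j, ∀ᶠ x in 𝓝 x₀, ContinuousAt (p j) x)
    (hg₀ : ∀ i, g i x₀ = 0) (hp₀ : ∀ j, p j x₀ ≤ 0)
    (hmin : ∀ᶠ x in 𝓝 x₀, x ∈ K → (∀ i, g i x = 0) → (∀ j, p j x ≤ 0) → f x₀ ≤ f x) :
    ∃ x : ℕ → E, (∀ n, x n ∈ K) ∧ Tendsto x (hyperfilter ℕ) (𝓝 x₀) ∧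
      ∀ᶠ n : ℕ in hyperfilter ℕ,
        IsLocalMinOn (penalizedObjective f g p x₀ n) K (x n) := by
  have hev := hf.and ((eventually_all.2 hg).and ((eventually_all.2 hp).and hmin))
  obtain ⟨r, hr, hball⟩ := Metric.nhds_basis_closedBall.eventually_iff.1 hev
  have hC : IsCompact (K ∩ Metric.closedBall x₀ r) := hK.inter_right Metric.isClosed_closedBall
  have hx₀C : x₀ ∈ K ∩ Metric.closedBall x₀ r := ⟨hx₀, Metric.mem_closedBall_self hr.le⟩
  have hPc : ∀ z ∈ Metric.closedBall x₀ r, ContinuousAt (quadraticPenalty g p) z := by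
    intro z hz
    obtain ⟨-, h2, h3, -⟩ := hball hz
    unfold quadraticPenalty
    exact (tendsto_finsetSum _ fun i _ => (h2 i).pow 2).add
      (tendsto_finsetSum _ fun j _ => (continuousAt_const.max (h3 j)).pow 2)
  have hP0 : quadraticPenalty g p x₀ = 0 := (quadraticPenalty_eq_zero_iff g p x₀).2 ⟨hg₀, hp₀⟩
  have hex : ∀ n : ℕ, ∃ z ∈ K ∩ Metric.closedBall x₀ r,
      IsMinOn (penalizedObjective f g p x₀ n) (K ∩ Metric.closedBall x₀ r) z := by
    intro n
    refine hC.exists_isMinOn ⟨x₀, hx₀C⟩ fun z hz => ContinuousAt.continuousWithinAt ?_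
    exact ((hball hz.2).1.add (by fun_prop)).add (continuousAt_const.mul (hPc z hz.2))
  choose x hxC hxmin using hex
  have hle : ∀ n : ℕ, f (x n) + ‖x n - x₀‖ ^ 2 + n / 2 * quadraticPenalty g p (x n) ≤ f x₀ := by
    intro n
    have := hxmin n hx₀C
    simpa [penalizedObjective, hP0] using this
  obtain ⟨z, hzC, hz⟩ := hC.ultrafilter_le_nhds' ((hyperfilter ℕ).map x)
    (Ultrafilter.mem_map.2 (univ_mem' hxC))
  have hz : Tendsto x (hyperfilter ℕ) (𝓝 z) := hz
  have hfz : Tendsto (fun n => f (x n)) (hyperfilter ℕ) (𝓝 (f z)) := (hball hzC.2).1.tendsto.comp hz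
  have hnz : Tendsto (fun n => ‖x n - x₀‖ ^ 2) (hyperfilter ℕ) (𝓝 (‖z - x₀‖ ^ 2)) :=
    ((hz.sub_const x₀).norm).pow 2
  have hPz := (hPc z hzC.2).tendsto.comp hz
  have hatTop : Tendsto (fun n : ℕ => (n : ℝ) / 2) (hyperfilter ℕ) atTop :=
    (tendsto_natCast_atTop_atTop.atTop_div_const two_pos).mono_left Nat.hyperfilter_le_atTop
  have hPz0 : quadraticPenalty g p z = 0 := by
    by_contra hne
    have hpos : 0 < quadraticPenalty g p z :=
      lt_of_le_of_ne (quadraticPenalty_nonneg g p z) (Ne.symm hne)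
    have h1 := (hfz.add hnz).add_atTop (hatTop.atTop_mul_pos hpos hPz)
    obtain ⟨n, hn⟩ := (h1.eventually_gt_atTop (f x₀)).exists
    exact absurd (hle n) (not_le.2 hn)
  have hfeas := (quadraticPenalty_eq_zero_iff g p z).1 hPz0
  have hlim : f z + ‖z - x₀‖ ^ 2 ≤ f x₀ := by
    refine le_of_tendsto (hfz.add hnz) (Eventually.of_forall fun n => ?_)
    have := mul_nonneg (by positivity : (0 : ℝ) ≤ (n : ℝ) / 2) (quadraticPenalty_nonneg g p (x n))
    linarith [hle n]
  have hzx : z = x₀ := by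
    have := (hball hzC.2).2.2.2 hzC.1 hfeas.1 hfeas.2
    have h0 : ‖z - x₀‖ ^ 2 = 0 := le_antisymm (by linarith) (by positivity)
    simpa [sub_eq_zero] using h0
  subst hzx
  refine ⟨x, fun n => (hxC n).1, hz, ?_⟩
  filter_upwards [hz (Metric.ball_mem_nhds z hr)] with n hn
  have hn : Metric.closedBall z r ∈ 𝓝 (x n) :=
    mem_of_superset (Metric.isOpen_ball.mem_nhds hn) Metric.ball_subset_closedBall
  have := (hxmin n).localize
  unfold IsLocalMinOn IsMinFilter at this ⊢
  rwa [Set.inter_comm, nhdsWithin_inter_of_mem (mem_nhdsWithin_of_mem_nhds hn)] at this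

/-- **Fritz John conditions** for a local minimum of `f` over a compact convex set subject to
finitely many equality constraints `g i = 0` and inequality constraints `p j ≤ 0`. -/
theorem exists_fritzJohn_multipliers [InnerProductSpace ℝ E] {K : Set E} (hK : IsCompact K)
    (hKc : Convex ℝ K)
    {f : E → ℝ} {g : ι → E → ℝ} {p : κ → E → ℝ} {x₀ : E} (hx₀ : x₀ ∈ K)
    (hf : ContDiffAt ℝ 1 f x₀) (hg : ∀ i, ContDiffAt ℝ 1 (g i) x₀)
    (hp : ∀ j, ContDiffAt ℝ 1 (p j) x₀)
    (hg₀ : ∀ i, g i x₀ = 0) (hp₀ : ∀ j, p j x₀ ≤ 0)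
    (hmin : ∀ᶠ x in 𝓝 x₀, x ∈ K → (∀ i, g i x = 0) → (∀ j, p j x ≤ 0) → f x₀ ≤ f x) :
    ∃ (l : ℝ) (a : ι → ℝ) (b : κ → ℝ), (l, a, b) ≠ 0 ∧ 0 ≤ l ∧ (∀ j, 0 ≤ b j) ∧
      (∀ j, b j * p j x₀ = 0) ∧
      ∀ y ∈ K, 0 ≤ l * fderiv ℝ f x₀ (y - x₀) + ∑ i, a i * fderiv ℝ (g i) x₀ (y - x₀)
        + ∑ j, b j * fderiv ℝ (p j) x₀ (y - x₀) := by
  have hf' := hf.eventually (by simp)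
  have hg' := fun i => (hg i).eventually (by simp)
  have hp' := fun j => (hp j).eventually (by simp)
  obtain ⟨x, hxK, hx, hloc⟩ := exists_tendsto_isLocalMinOn_penalizedObjective hK hx₀
    (hf'.mono fun _ h => h.continuousAt) (fun i => (hg' i).mono fun _ h => h.continuousAt)
    (fun j => (hp' j).mono fun _ h => h.continuousAt) hg₀ hp₀ hmin
  let m : ℕ → ℝ × (ι → ℝ) × (κ → ℝ) := fun n =>
    (1, fun i => n * g i (x n), fun j => n * max 0 (p j (x n)))
  have hm1 : ∀ n, 1 ≤ ‖m n‖ := fun n => by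
    simpa only [m, norm_one] using norm_fst_le (m n)
  have hm0 : ∀ n, 0 < ‖m n‖ := fun n => one_pos.trans_le (hm1 n)
  obtain ⟨M, hM, hMlim⟩ := (isCompact_sphere (0 : ℝ × (ι → ℝ) × (κ → ℝ)) 1).ultrafilter_le_nhds'
    ((hyperfilter ℕ).map fun n => ‖m n‖⁻¹ • m n)
    (Ultrafilter.mem_map.2 (univ_mem' fun n => by
      simp [norm_smul, inv_mul_cancel₀ (hm0 n).ne']))
  have hMlim : Tendsto (fun n => ‖m n‖⁻¹ • m n) (hyperfilter ℕ) (𝓝 M) := hMlim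
  obtain ⟨l, a, b⟩ := M
  have hl : Tendsto (fun n => ‖m n‖⁻¹) (hyperfilter ℕ) (𝓝 l) := by
    simpa [m] using hMlim.fst_nhds
  have ha : ∀ i, Tendsto (fun n => ‖m n‖⁻¹ * (n * g i (x n))) (hyperfilter ℕ) (𝓝 (a i)) :=
    fun i => tendsto_pi_nhds.1 hMlim.snd_nhds.fst_nhds i
  have hb : ∀ j, Tendsto (fun n => ‖m n‖⁻¹ * (n * max 0 (p j (x n)))) (hyperfilter ℕ) (𝓝 (b j)) :=
    fun j => tendsto_pi_nhds.1 hMlim.snd_nhds.snd_nhds j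
  refine ⟨l, a, b, ?_, ge_of_tendsto' hl fun n => by positivity,
    fun j => ge_of_tendsto' (hb j) fun n => by positivity, fun j => ?_, fun y hy => ?_⟩
  · rintro h
    rw [h] at hM
    simp at hM
  · rcases (hp₀ j).lt_or_eq with hj | hj
    · have h1 := ((hp j).continuousAt.tendsto.comp hx).eventually (gt_mem_nhds hj)
      have : b j = 0 := by
        refine tendsto_nhds_unique (hb j) (tendsto_const_nhds.congr' ?_)
        filter_upwards [h1] with n hn
        have hn : p j (x n) < 0 := hn
        simp [max_eq_left hn.le]
      simp [this]
    · simp [hj]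
  · have hyx : Tendsto (fun n => y - x n) (hyperfilter ℕ) (𝓝 (y - x₀)) := hx.const_sub y
    have hd : ∀ {q : E → ℝ}, ContDiffAt ℝ 1 q x₀ →
        Tendsto (fun n => fderiv ℝ q (x n) (y - x n)) (hyperfilter ℕ)
          (𝓝 (fderiv ℝ q x₀ (y - x₀))) := fun {q} hq =>
      (isBoundedBilinearMap_apply.continuous.tendsto (fderiv ℝ q x₀, y - x₀)).comp
        (((hq.continuousAt_fderiv one_ne_zero).tendsto.comp hx).prodMk_nhds hyx)
    have hin : Tendsto (fun n => 2 * inner ℝ (x n - x₀) (y - x n)) (hyperfilter ℕ) (𝓝 0) := by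
      simpa using ((hx.sub_const x₀).inner (𝕜 := ℝ) hyx).const_mul 2
    have hlim := (((hl.mul (hd hf)).add (hl.mul hin)).add
      (tendsto_finsetSum Finset.univ fun i _ => (ha i).mul (hd (hg i)))).add
      (tendsto_finsetSum Finset.univ fun j _ => (hb j).mul (hd (hp j)))
    rw [mul_zero, add_zero] at hlim
    refine ge_of_tendsto hlim ?_
    filter_upwards [hloc, hx.eventually hf', hx.eventually (eventually_all.2 hg'),
      hx.eventually (eventually_all.2 hp')] with n h1 h2 h3 h4
    have key := penalizedObjective_stationary hKc (hxK n) h1 (h2.differentiableAt one_ne_zero)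
      (fun i => (h3 i).differentiableAt one_ne_zero)
      (fun j => (h4 j).differentiableAt one_ne_zero) hy
    have := mul_nonneg (inv_nonneg.2 (norm_nonneg (m n))) key
    refine this.trans_eq ?_
    simp only [mul_add, Finset.mul_sum, mul_assoc]

/-- Fritz John conditions with the multiplier of the objective normalized to `0` or `1`. -/
theorem exists_normalized_fritzJohn_multipliers [InnerProductSpace ℝ E] {K : Set E}
    (hK : IsCompact K) (hKc : Convex ℝ K)
    {f : E → ℝ} {g : ι → E → ℝ} {p : κ → E → ℝ} {x₀ : E} (hx₀ : x₀ ∈ K)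
    (hf : ContDiffAt ℝ 1 f x₀) (hg : ∀ i, ContDiffAt ℝ 1 (g i) x₀)
    (hp : ∀ j, ContDiffAt ℝ 1 (p j) x₀)
    (hg₀ : ∀ i, g i x₀ = 0) (hp₀ : ∀ j, p j x₀ ≤ 0)
    (hmin : ∀ᶠ x in 𝓝 x₀, x ∈ K → (∀ i, g i x = 0) → (∀ j, p j x ≤ 0) → f x₀ ≤ f x) :
    ∃ (l : ℝ) (a : ι → ℝ) (b : κ → ℝ), (l, a, b) ≠ 0 ∧ (l = 1 ∨ l = 0) ∧ (∀ j, 0 ≤ b j) ∧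
      (∀ j, b j * p j x₀ = 0) ∧
      ∀ y ∈ K, 0 ≤ l * fderiv ℝ f x₀ (y - x₀) + ∑ i, a i * fderiv ℝ (g i) x₀ (y - x₀)
        + ∑ j, b j * fderiv ℝ (p j) x₀ (y - x₀) := by
  obtain ⟨l, a, b, hne, hl, hb, hbp, hK⟩ :=
    exists_fritzJohn_multipliers hK hKc hx₀ hf hg hp hg₀ hp₀ hmin
  rcases hl.eq_or_lt with rfl | hl
  · exact ⟨0, a, b, hne, Or.inr rfl, hb, hbp, hK⟩
  · refine ⟨1, l⁻¹ • a, l⁻¹ • b, by simp [Prod.ext_iff], Or.inl rfl,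
      fun j => mul_nonneg (inv_nonneg.2 hl.le) (hb j), fun j => ?_, fun y hy => ?_⟩
    · simp [mul_assoc, hbp j]
    · refine (mul_nonneg (inv_nonneg.2 hl.le) (hK y hy)).trans_eq ?_
      simp [mul_add, Finset.mul_sum, mul_assoc, hl.ne']

end FritzJohn

/-- The planar rotation matrix of angle `θ`. -/
noncomputable def planarRotation (θ : ℝ) : Matrix (Fin 2) (Fin 2) ℝ :=
  !![Real.cos θ, -Real.sin θ; Real.sin θ, Real.cos θ]

theorem planarRotation_zero : planarRotation 0 = 1 := by
  simp [planarRotation, Matrix.one_fin_two]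

theorem planarRotation_add (θ φ : ℝ) :
    planarRotation (θ + φ) = planarRotation θ * planarRotation φ := by
  ext i j
  fin_cases i <;> fin_cases j <;>
    simp [planarRotation, Real.cos_add, Real.sin_add] <;> ring

theorem Fstep_eq_planarRotation {h ω : ℝ} (hω : |h * ω| ≤ 1) :
    Fstep h ω = planarRotation (Real.arcsin (h * ω)) := by
  rw [abs_le] at hω
  simp [Fstep, planarRotation, Real.cos_arcsin, Real.sin_arcsin hω.1 hω.2, mul_pow]

theorem attitude_succ_eq {h : ℝ} {R : ℕ → Matrix (Fin 2) (Fin 2) ℝ} {ω : ℕ → ℝ} {n : ℕ}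
    (hR : ∀ t < n + 1, R (t + 1) = R t * Fstep h (ω t))
    (hω : ∀ t < n, |h * ω (t + 1)| ≤ 1) :
    R (n + 1) = R 0 * Fstep h (ω 0) *
      planarRotation (∑ t ∈ Finset.range n, Real.arcsin (h * ω (t + 1))) := by
  induction n with
  | zero => simp [hR 0, planarRotation_zero]
  | succ n ih =>
    rw [hR (n + 1) (by lia), ih (fun t ht => hR t (by lia)) (fun t ht => hω t (by lia)),
      Finset.sum_range_succ, planarRotation_add, Fstep_eq_planarRotation (hω n (by lia)),
      ← mul_assoc]

/-- The momentum increment accumulated before time `t`, as a function of the control sequence. -/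
noncomputable def momentumIncrement (h : ℝ) (N t : ℕ) : EuclideanSpace ℝ (Fin N) →L[ℝ] ℝ :=
  ∑ i : Fin N, if (i : ℕ) < t then h • EuclideanSpace.proj i else 0

theorem momentumIncrement_apply (h : ℝ) (N t : ℕ) (v : EuclideanSpace ℝ (Fin N)) :
    momentumIncrement h N t v = ∑ i : Fin N, if (i : ℕ) < t then h * v i else 0 := by
  rw [momentumIncrement, sum_apply]
  refine Finset.sum_congr rfl fun i _ => ?_
  split_ifs <;> simp

theorem momentumIncrement_zero (h : ℝ) (N : ℕ) (v : EuclideanSpace ℝ (Fin N)) :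
    momentumIncrement h N 0 v = 0 := by
  simp [momentumIncrement_apply]

theorem momentumIncrement_succ (h : ℝ) {N t : ℕ} (ht : t < N) (v : EuclideanSpace ℝ (Fin N)) :
    momentumIncrement h N (t + 1) v = momentumIncrement h N t v + h * v ⟨t, ht⟩ := by
  have : h * v ⟨t, ht⟩ = ∑ i : Fin N, if i = ⟨t, ht⟩ then h * v i else 0 := by simp
  rw [this, momentumIncrement_apply, momentumIncrement_apply, ← Finset.sum_add_distrib]
  refine Finset.sum_congr rfl fun i _ => ?_
  simp only [Fin.ext_iff]
  split_ifs <;> first | lia | simp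

theorem momentumIncrement_single (h : ℝ) {N : ℕ} (t : ℕ) (s : Fin N) (δ : ℝ) :
    momentumIncrement h N t (EuclideanSpace.single s δ) = if (s : ℕ) < t then h * δ else 0 := by
  rw [momentumIncrement_apply, Finset.sum_eq_single s] <;> simp +contextual

/-- The set of control sequences with values in `[-c, c]`. -/
def controlBox (c : ℝ) (N : ℕ) : Set (EuclideanSpace ℝ (Fin N)) :=
  {u | ∀ i, |u i| ≤ c}

theorem isCompact_controlBox (c : ℝ) (N : ℕ) : IsCompact (controlBox c N) := by
  have : IsCompact (Set.univ.pi fun _ : Fin N => Set.Icc (-c) c) :=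
    isCompact_univ_pi fun _ => isCompact_Icc
  have h2 := (EuclideanSpace.equiv (Fin N) ℝ).symm.toHomeomorph.isCompact_image.2 this
  convert h2 using 1
  ext u
  constructor
  · intro hu
    exact ⟨u.ofLp, fun i _ => abs_le.1 (hu i), rfl⟩
  · rintro ⟨v, hv, rfl⟩ i
    exact abs_le.2 (hv i trivial)

theorem convex_controlBox (c : ℝ) (N : ℕ) : Convex ℝ (controlBox c N) := by
  have : controlBox c N = ⋂ i, (EuclideanSpace.proj i : _ →L[ℝ] ℝ) ⁻¹' Set.Icc (-c) c := by
    ext u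
    simp [controlBox, abs_le]
  rw [this]
  exact convex_iInter fun i => (convex_Icc _ _).linear_preimage
    (EuclideanSpace.proj i : EuclideanSpace ℝ (Fin N) →L[ℝ] ℝ).toLinearMap

/-- **First-order necessary optimality conditions for energy-optimal single-axis
spacecraft maneuvers on SO(2).**
Minimize `Σ_{t<N} u_t²/2` subject to `R_{t+1} = R_t F(ω_t)`, `ω_{t+1} = ω_t + h u_t`,
`|u_t| ≤ c`, state constraints `(ω_t² − d²)/2 ≤ 0` for `t = 1,…,N−1`, and fixed
boundary conditions.  If `(û, R̂, ω̂)` is optimal then there exist multipliers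
`ζ^t, ξ^t` (`t = 0,…,N−1`), `μ^t` (`t = 1,…,N−1`) and `ν ∈ {−1,0}`, not all zero,
satisfying the adjoint equations, the state equations, complementary slackness,
non-positivity, and pointwise Hamiltonian maximization over `[−c,c]`. -/
theorem stmt_12 (h c d : ℝ) (hh : 0 < h) (hc : 0 < c) (hd : 0 < d) (hhd : h * d < 1)
    (N : ℕ) (hN : 0 < N)
    (Ri Rf : Matrix (Fin 2) (Fin 2) ℝ) (hRi : Ri ∈ SO2) (hRf : Rf ∈ SO2)
    (ωi ωf : ℝ)
    -- the optimal control and the corresponding state trajectory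
    (uo : ℕ → ℝ) (Ro : ℕ → Matrix (Fin 2) (Fin 2) ℝ) (ωo : ℕ → ℝ)
    (hR0 : Ro 0 = Ri) (hω0 : ωo 0 = ωi) (hRN : Ro N = Rf) (hωN : ωo N = ωf)
    (hdynR : ∀ t < N, Ro (t+1) = Ro t * Fstep h (ωo t))
    (hdynω : ∀ t < N, ωo (t+1) = ωo t + h * uo t)
    (hubnd : ∀ t < N, |uo t| ≤ c)
    (hstate : ∀ t, 1 ≤ t → t < N → (ωo t^2 - d^2) / 2 ≤ 0)
    -- optimality among all admissible trajectories
    (hopt : ∀ (u : ℕ → ℝ) (R : ℕ → Matrix (Fin 2) (Fin 2) ℝ) (ω : ℕ → ℝ),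
      R 0 = Ri → ω 0 = ωi → R N = Rf → ω N = ωf →
      (∀ t < N, R (t+1) = R t * Fstep h (ω t)) →
      (∀ t < N, ω (t+1) = ω t + h * u t) →
      (∀ t < N, |u t| ≤ c) →
      (∀ t, 1 ≤ t → t < N → (ω t^2 - d^2) / 2 ≤ 0) →
      ∑ t ∈ Finset.range N, uo t^2 / 2 ≤ ∑ t ∈ Finset.range N, u t^2 / 2) :
    ∃ (ζ ξ : ℕ → ℝ) (μ : ℕ → ℝ) (ν : ℝ),
      (ν = -1 ∨ ν = 0) ∧
      -- not all zero
      ¬ ((∀ t < N, ζ t = 0 ∧ ξ t = 0) ∧ (∀ t, 1 ≤ t → t < N → μ t = 0) ∧ ν = 0) ∧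
      -- (i) adjoint dynamics
      (∀ t, 1 ≤ t → t < N →
        ζ (t-1) = ζ t ∧
        ξ (t-1) = h * ζ t / Real.sqrt (1 - h^2 * ωo t^2) + ξ t + μ t * ωo t) ∧
      -- (i) state dynamics
      (∀ t < N, Ro (t+1) = Ro t * Fstep h (ωo t) ∧ ωo (t+1) = ωo t + h * uo t) ∧
      -- (ii) complementary slackness
      (∀ t, 1 ≤ t → t < N → μ t * (ωo t^2 - d^2) = 0) ∧
      -- (iii) non-positivity
      (∀ t, 1 ≤ t → t < N → μ t ≤ 0) ∧
      -- (iv) pointwise Hamiltonian maximization over `[−c,c]`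
      (∀ t < N, ∀ w ∈ Set.Icc (-c) c,
        HamSO2 h ν (ζ t) (ξ t) (ωo t) w ≤ HamSO2 h ν (ζ t) (ξ t) (ωo t) (uo t)) := by
  obtain ⟨n, rfl⟩ : ∃ n, N = n + 1 := ⟨N - 1, by lia⟩
  let uE : EuclideanSpace ℝ (Fin (n + 1)) := WithLp.toLp 2 fun i => uo i
  let L := momentumIncrement h (n + 1)
  have hW : ∀ t ≤ n + 1, ωi + L t uE = ωo t := by
    intro t
    induction t with
    | zero => simp [L, momentumIncrement_zero, hω0]
    | succ t ih =>
      intro ht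
      rw [hdynω t (by lia), ← ih (by lia)]
      simp only [L, momentumIncrement_succ h (show t < n + 1 by lia), uE]
      ring
  have habs : ∀ {x : ℝ}, (x ^ 2 - d ^ 2) / 2 ≤ 0 → |h * x| < 1 := by
    intro x hx
    rw [abs_mul, abs_of_pos hh]
    exact (mul_le_mul_of_nonneg_left (abs_le_of_sq_le_sq (by linarith) hd.le) hh.le).trans_lt hhd
  have hωlt : ∀ t < n, |h * ωo (t + 1)| < 1 := fun t ht =>
    habs (hstate (t + 1) (by lia) (by lia))
  let f : EuclideanSpace ℝ (Fin (n + 1)) → ℝ := fun u => ∑ i, u i ^ 2 / 2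
  let g : Fin 2 → EuclideanSpace ℝ (Fin (n + 1)) → ℝ :=
    ![fun u => ∑ t ∈ Finset.range n, Real.arcsin (h * (ωi + L (t + 1) u))
        - ∑ t ∈ Finset.range n, Real.arcsin (h * ωo (t + 1)),
      fun u => ωi + L (n + 1) u - ωf]
  let p : Fin n → EuclideanSpace ℝ (Fin (n + 1)) → ℝ :=
    fun j u => ((ωi + L (j + 1) u) ^ 2 - d ^ 2) / 2
  have huE : uE ∈ controlBox c (n + 1) := fun i => hubnd i i.2
  have hmin : ∀ u ∈ controlBox c (n + 1), (∀ i, g i u = 0) → (∀ j, p j u ≤ 0) → f uE ≤ f u := by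
    intro u hu hgu hpu
    obtain ⟨hg0, hg1⟩ := Fin.forall_fin_two.1 hgu
    have hg0 : ∑ t ∈ Finset.range n, Real.arcsin (h * (ωi + L (t + 1) u)) =
        ∑ t ∈ Finset.range n, Real.arcsin (h * ωo (t + 1)) := sub_eq_zero.1 hg0
    have hg1 : ωi + L (n + 1) u = ωf := sub_eq_zero.1 hg1
    let ω : ℕ → ℝ := fun t => ωi + L t u
    let R : ℕ → Matrix (Fin 2) (Fin 2) ℝ := fun t => Nat.rec Ri (fun s A => A * Fstep h (ω s)) t
    have hω0' : ω 0 = ωi := by simp [ω, L, momentumIncrement_zero]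
    have hst : ∀ t < n, (ω (t + 1) ^ 2 - d ^ 2) / 2 ≤ 0 := fun t ht => hpu ⟨t, ht⟩
    have key := hopt (fun t => if ht : t < n + 1 then u ⟨t, ht⟩ else 0) R ω rfl hω0' ?_ hg1
      (fun t _ => rfl) ?_ ?_ ?_
    · rw [Finset.sum_range, Finset.sum_range] at key
      simpa only [f, uE, Fin.is_lt, dite_true, Fin.eta] using key
    · rw [← hRN, attitude_succ_eq (R := R) (ω := ω) (fun t _ => rfl)
        (fun t ht => (habs (hst t ht)).le), attitude_succ_eq hdynR (fun t ht => (hωlt t ht).le),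
        hR0, hω0, hω0', hg0]
      rfl
    · intro t ht
      simp only [ω, L, momentumIncrement_succ h ht, dif_pos ht]
      ring
    · intro t ht
      simpa only [dif_pos ht] using hu ⟨t, ht⟩
    · intro t h1 ht
      obtain ⟨s, rfl⟩ := Nat.exists_eq_add_of_le' h1
      exact hst s (by lia)
  have hLd : ∀ t, HasStrictFDerivAt (fun u => ωi + L t u) (L t) uE := fun t =>
    (L t).hasStrictFDerivAt.const_add ωi
  have hLc : ∀ t, ContDiff ℝ 1 (fun u => ωi + L t u) := fun t =>
    contDiff_const.add (L t).contDiff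
  have harc : ∀ t < n, h * (ωi + L (t + 1) uE) ≠ -1 ∧ h * (ωi + L (t + 1) uE) ≠ 1 := by
    intro t ht
    rw [hW (t + 1) (by lia)]
    have := abs_lt.1 (hωlt t ht)
    exact ⟨this.1.ne', this.2.ne⟩
  have hf : ContDiffAt ℝ 1 f uE := by
    simp only [f]
    fun_prop
  have hg : ∀ i, ContDiffAt ℝ 1 (g i) uE := by
    refine Fin.forall_fin_two.2 ⟨?_, ?_⟩
    · refine ContDiffAt.sub (ContDiffAt.sum fun t ht => ?_) contDiffAt_const
      have ht := harc t (Finset.mem_range.1 ht)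
      exact ContDiffAt.comp (g := Real.arcsin) uE (Real.contDiffAt_arcsin ht.1 ht.2)
        (contDiffAt_const.mul (hLc (t + 1)).contDiffAt)
    · exact (hLc (n + 1)).contDiffAt.sub contDiffAt_const
  have hp : ∀ j, ContDiffAt ℝ 1 (p j) uE := fun j =>
    ((((hLc (j + 1)).pow 2).sub contDiff_const).div_const 2).contDiffAt
  have hg₀ : ∀ i, g i uE = 0 := by
    refine Fin.forall_fin_two.2 ⟨sub_eq_zero.2 (Finset.sum_congr rfl fun t ht => ?_),
      sub_eq_zero.2 ?_⟩
    · rw [hW (t + 1) (by have := Finset.mem_range.1 ht; lia)]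
    · rw [hW (n + 1) le_rfl, hωN]
  have hp₀ : ∀ j, p j uE ≤ 0 := fun j => by
    simp only [p]
    rw [hW (j + 1) (by lia)]
    exact hstate (j + 1) (by lia) (by lia)
  have hfd : ∀ v, fderiv ℝ f uE v = ∑ i, uE i * v i := by
    intro v
    have h1 := HasFDerivAt.fun_sum (u := Finset.univ) fun (i : Fin (n + 1)) _ =>
      (((EuclideanSpace.proj i : EuclideanSpace ℝ (Fin (n + 1)) →L[ℝ] ℝ).hasFDerivAt
        (x := uE)).pow 2).mul_const (2⁻¹ : ℝ)
    have h2 : HasFDerivAt f _ uE := h1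
    rw [h2.fderiv]
    simp [sum_apply, mul_assoc]
  have hgd0 : ∀ v, fderiv ℝ (g 0) uE v =
      ∑ t ∈ Finset.range n, h / √(1 - h ^ 2 * ωo (t + 1) ^ 2) * L (t + 1) v := by
    intro v
    have h1 := (HasFDerivAt.fun_sum (u := Finset.range n) fun t ht =>
      (Real.hasDerivAt_arcsin (harc t (Finset.mem_range.1 ht)).1
        (harc t (Finset.mem_range.1 ht)).2).comp_hasFDerivAt uE
        ((hLd (t + 1)).hasFDerivAt.const_mul h)).sub_const
        (∑ t ∈ Finset.range n, Real.arcsin (h * ωo (t + 1)))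
    have h2 : HasFDerivAt (g 0) _ uE := h1
    rw [h2.fderiv, sum_apply]
    refine Finset.sum_congr rfl fun t ht => ?_
    rw [hW (t + 1) (by have := Finset.mem_range.1 ht; lia)]
    simp only [smul_apply, smul_eq_mul, mul_pow]
    ring
  have hgd1 : ∀ v, fderiv ℝ (g 1) uE v = L (n + 1) v := by
    intro v
    have h2 : HasFDerivAt (g 1) (L (n + 1)) uE := (hLd (n + 1)).hasFDerivAt.sub_const ωf
    rw [h2.fderiv]
  have hpd : ∀ j v, fderiv ℝ (p j) uE v = ωo (j + 1) * L (j + 1) v := by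
    intro j v
    have h2 : HasFDerivAt (p j) _ uE :=
      (((hLd (j + 1)).hasFDerivAt.pow 2).sub_const (d ^ 2)).mul_const (2⁻¹ : ℝ)
    rw [h2.fderiv, hW (j + 1) (by lia)]
    simp [mul_assoc]
  obtain ⟨l, a, b, hne, hl, hb, hbp, hstat⟩ := exists_normalized_fritzJohn_multipliers
    (isCompact_controlBox c (n + 1)) (convex_controlBox c (n + 1)) huE hf hg hp hg₀ hp₀
    (Eventually.of_forall hmin)
  let β : ℕ → ℝ := fun t => if ht : t < n then b ⟨t, ht⟩ else 0
  let G : ℕ → ℝ := fun t => a 0 * (h / √(1 - h ^ 2 * ωo (t + 1) ^ 2)) + β t * ωo (t + 1)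
  let Ξ : ℕ → ℝ := fun s => ∑ t ∈ Finset.Ico s n, G t + a 1
  have hβ0 : ∀ t, 0 ≤ β t := fun t => by
    simp only [β]
    split_ifs
    exacts [hb _, le_rfl]
  have hβp : ∀ t < n, β t * (ωo (t + 1) ^ 2 - d ^ 2) = 0 := fun t ht => by
    have := hbp ⟨t, ht⟩
    simp only [p] at this
    rw [hW (t + 1) (by lia)] at this
    simp only [β, dif_pos ht]
    linarith
  have hvar : ∀ s < n + 1, ∀ w ∈ Set.Icc (-c) c, 0 ≤ (w - uo s) * (l * uo s + h * Ξ s) := by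
    intro s hs w hw
    let v : EuclideanSpace ℝ (Fin (n + 1)) := EuclideanSpace.single ⟨s, hs⟩ (w - uo s)
    have hy : uE + v ∈ controlBox c (n + 1) := by
      intro i
      by_cases hi : i = ⟨s, hs⟩
      · subst hi
        simpa [uE, v] using abs_le.2 hw
      · simpa [uE, v, hi] using hubnd i i.2
    have key := hstat _ hy
    rw [add_sub_cancel_left, hfd, Fin.sum_univ_two, hgd0, hgd1] at key
    simp only [hpd] at key
    have hb' : ∑ j, b j * (ωo (j + 1) * L (j + 1) v) =
        ∑ t ∈ Finset.range n, β t * (ωo (t + 1) * L (t + 1) v) := by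
      rw [Finset.sum_range]
      simp [β]
    have hf' : ∑ i, uE i * v i = uo s * (w - uo s) := by
      rw [Finset.sum_eq_single ⟨s, hs⟩] <;> simp +contextual [uE, v]
    have hL : ∀ t, L t v = if s < t then h * (w - uo s) else 0 := fun t =>
      momentumIncrement_single h t ⟨s, hs⟩ (w - uo s)
    have hIco : Finset.Ico s n = (Finset.range n).filter (fun t => s < t + 1) := by
      ext t
      simp only [Finset.mem_Ico, Finset.mem_filter, Finset.mem_range]
      lia
    have hG : a 0 * ∑ t ∈ Finset.range n, h / √(1 - h ^ 2 * ωo (t + 1) ^ 2) * L (t + 1) v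
        + ∑ t ∈ Finset.range n, β t * (ωo (t + 1) * L (t + 1) v)
        = (∑ t ∈ Finset.Ico s n, G t) * (h * (w - uo s)) := by
      rw [hIco, Finset.sum_filter, Finset.sum_mul, Finset.mul_sum, ← Finset.sum_add_distrib]
      refine Finset.sum_congr rfl fun t _ => ?_
      rw [hL]
      split_ifs
      · simp only [G]
        ring
      · simp
    rw [hb', hf', hL (n + 1), if_pos hs] at key
    simp only [Ξ]
    linarith
  refine ⟨fun _ => -a 0, fun s => -Ξ s, fun t => -β (t - 1), -l, ?_, ?_, ?_,
    fun t ht => ⟨hdynR t ht, hdynω t ht⟩, ?_, ?_, ?_⟩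
  · rcases hl with rfl | rfl <;> simp
  · rintro ⟨h1, h2, h3⟩
    apply hne
    have ha0 : a 0 = 0 := neg_eq_zero.1 (h1 0 hN).1
    have ha1 : a 1 = 0 := by simpa [Ξ] using (h1 n (by lia)).2
    have hbz : b = 0 := by
      ext j
      simpa [β] using h2 (j + 1) (by lia) (by lia)
    have haz : a = 0 := by
      ext i
      fin_cases i
      exacts [ha0, ha1]
    simp [neg_eq_zero.1 h3, haz, hbz]
  · intro t h1 ht
    obtain ⟨s, rfl⟩ := Nat.exists_eq_add_of_le' h1
    refine ⟨rfl, ?_⟩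
    simp only [Ξ, Nat.add_sub_cancel]
    rw [Finset.sum_eq_sum_Ico_succ_bot (show s < n by lia)]
    simp only [G]
    ring
  · intro t h1 ht
    obtain ⟨s, rfl⟩ := Nat.exists_eq_add_of_le' h1
    simpa using hβp s (by lia)
  · intro t _ _
    simpa using hβ0 (t - 1)
  · intro t ht w hw
    have h1 := hvar t ht w hw
    have hl0 : 0 ≤ l := by rcases hl with rfl | rfl <;> norm_num
    have h2 := mul_nonneg hl0 (sq_nonneg (w - uo t))
    simp only [HamSO2]
    nlinarith
end
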